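/- arXiv:2601.08108 — 6 statements merged into one kernel-verified Lean document; each statement's English description precedes it below -/
import Mathlib

section
/- In the standard front-door SCM, for every query value q* ∈ Q and every answer a ∈ A, the interventional probability satisfies the front-door adjustment formula P(a | do(Q=q*)) = Σ_{r∈R} P_obs(r | q*) · Σ_{q∈Q} P_obs(a | r, q) · P_obs(q), provided that P_obs(q) > 0 for every q ∈ Q and P_obs(r, q) > 0 for every r ∈ R and q ∈ Q. -/
open Finset

variable {U Q R A : Type*} [Fintype U] [Fintype Q] [Fintype R] [Fintype A]

/-- Observational joint distribution of the standard front-door SCM: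
`p(u, q, r, a) = pU(u) * pQ(u)(q) * pR(q)(r) * pA(r)(u)(a)`. -/
def sfdJoint (pU : U → ℝ) (pQ : U → Q → ℝ) (pR : Q → R → ℝ) (pA : R → U → A → ℝ)
    (u : U) (q : Q) (r : R) (a : A) : ℝ :=
  pU u * pQ u q * pR q r * pA r u a

/-- Observational marginal `P_obs(q)`. -/
def sfdPq (pU : U → ℝ) (pQ : U → Q → ℝ) (pR : Q → R → ℝ) (pA : R → U → A → ℝ)
    (q : Q) : ℝ :=
  ∑ u, ∑ r, ∑ a, sfdJoint pU pQ pR pA u q r a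

/-- Observational marginal `P_obs(r, q)`. -/
def sfdPrq (pU : U → ℝ) (pQ : U → Q → ℝ) (pR : Q → R → ℝ) (pA : R → U → A → ℝ)
    (r : R) (q : Q) : ℝ :=
  ∑ u, ∑ a, sfdJoint pU pQ pR pA u q r a

theorem sfdPrq_eq {pU : U → ℝ} {pQ : U → Q → ℝ} {pR : Q → R → ℝ} {pA : R → U → A → ℝ}
    (hA1 : ∀ r u, ∑ a, pA r u a = 1) (r : R) (q : Q) :
    sfdPrq pU pQ pR pA r q = (∑ u, pU u * pQ u q) * pR q r := by
  simp only [sfdPrq, sfdJoint, ← mul_sum, hA1, mul_one, sum_mul]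

theorem sfdPq_eq {pU : U → ℝ} {pQ : U → Q → ℝ} {pR : Q → R → ℝ} {pA : R → U → A → ℝ}
    (hR1 : ∀ q, ∑ r, pR q r = 1) (hA1 : ∀ r u, ∑ a, pA r u a = 1) (q : Q) :
    sfdPq pU pQ pR pA q = ∑ u, pU u * pQ u q := by
  simp only [sfdPq, sfdJoint, ← mul_sum, hA1, hR1, mul_one]

/-- The back-door sum `∑ q, P_obs(a | r, q) * P_obs(q)` equals `P(a | do(R = r))`. -/
theorem sum_sfdJoint_div_sfdPrq_mul_sfdPq
    {pU : U → ℝ} {pQ : U → Q → ℝ} {pR : Q → R → ℝ} {pA : R → U → A → ℝ}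
    (hQ1 : ∀ u, ∑ q, pQ u q = 1) (hR1 : ∀ q, ∑ r, pR q r = 1)
    (hA1 : ∀ r u, ∑ a, pA r u a = 1) {r : R} (hrq : ∀ q, sfdPrq pU pQ pR pA r q ≠ 0) (a : A) :
    ∑ q, ((∑ u, sfdJoint pU pQ pR pA u q r a) / sfdPrq pU pQ pR pA r q) *
      sfdPq pU pQ pR pA q = ∑ u, pU u * pA r u a := by
  have hterm (q : Q) : ((∑ u, sfdJoint pU pQ pR pA u q r a) / sfdPrq pU pQ pR pA r q) *
      sfdPq pU pQ pR pA q = ∑ u, pU u * pA r u a * pQ u q := by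
    have hjoint : ∑ u, sfdJoint pU pQ pR pA u q r a =
        (∑ u, pU u * pA r u a * pQ u q) * pR q r := by
      rw [sum_mul]
      exact sum_congr rfl fun u _ => by unfold sfdJoint; ring
    have hne := hrq q
    rw [sfdPrq_eq hA1] at hne
    rw [hjoint, sfdPrq_eq hA1, sfdPq_eq hR1 hA1]
    have hq := left_ne_zero_of_mul hne
    have hr := right_ne_zero_of_mul hne
    field_simp
  simp only [hterm]
  rw [sum_comm]
  simp only [← mul_sum, hQ1, mul_one]

/-- **Standard front-door adjustment.**
For every query value `q*` and every answer `a`, the interventional probability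
`P(a | do(Q = q*)) = ∑ u, ∑ r, pU(u) * pR(q*)(r) * pA(r)(u)(a)` (truncated factorization)
equals `∑ r, P_obs(r | q*) * ∑ q, P_obs(a | r, q) * P_obs(q)`, provided `P_obs(q) > 0`
for all `q` and `P_obs(r, q) > 0` for all `r, q`. -/
theorem standard_front_door_adjustment
    [Nonempty U] [Nonempty Q] [Nonempty R] [Nonempty A]
    (pU : U → ℝ) (pQ : U → Q → ℝ) (pR : Q → R → ℝ) (pA : R → U → A → ℝ)
    (hpU : ∀ u, 0 ≤ pU u) (hpQ : ∀ u q, 0 ≤ pQ u q)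
    (hpR : ∀ q r, 0 ≤ pR q r) (hpA : ∀ r u a, 0 ≤ pA r u a)
    (hU1 : ∑ u, pU u = 1) (hQ1 : ∀ u, ∑ q, pQ u q = 1)
    (hR1 : ∀ q, ∑ r, pR q r = 1) (hA1 : ∀ r u, ∑ a, pA r u a = 1)
    (hq : ∀ q : Q, 0 < sfdPq pU pQ pR pA q)
    (hrq : ∀ (r : R) (q : Q), 0 < sfdPrq pU pQ pR pA r q)
    (qstar : Q) (a : A) :
    (∑ u, ∑ r, pU u * pR qstar r * pA r u a) =
      ∑ r, (sfdPrq pU pQ pR pA r qstar / sfdPq pU pQ pR pA qstar) *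
        ∑ q, ((∑ u, sfdJoint pU pQ pR pA u q r a) / sfdPrq pU pQ pR pA r q) *
          sfdPq pU pQ pR pA q := by
  have hcond (r : R) : sfdPrq pU pQ pR pA r qstar / sfdPq pU pQ pR pA qstar = pR qstar r := by
    have hne := (hq qstar).ne'
    rw [sfdPq_eq hR1 hA1] at hne
    rw [sfdPrq_eq hA1, sfdPq_eq hR1 hA1, mul_div_cancel_left₀ _ hne]
  rw [sum_comm]
  refine sum_congr rfl fun r _ => ?_
  rw [hcond, sum_sfdJoint_div_sfdPrq_mul_sfdPq hQ1 hR1 hA1 (fun q => (hrq r q).ne'), mul_sum]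
  exact sum_congr rfl fun u _ => by ring
end

section
/- In the standard front-door SCM, for every u ∈ U, q ∈ Q, r ∈ R with P_obs(q, r) > 0 and P_obs(q) > 0, the posterior over the unobserved confounder is unchanged by further conditioning on the mediator: P_obs(u | q, r) = P_obs(u | q). Consequently, P_obs(a | r, q) = Σ_{u∈U} pA(r)(u)(a) · P_obs(u | q) for every a ∈ A. -/
open Finset

variable {U Q R A : Type*} [Fintype U] [Fintype Q] [Fintype R] [Fintype A]

omit [Fintype U] [Fintype Q] [Fintype R] in
lemma sum_sfdJoint_eq {pA : R → U → A → ℝ} (hA1 : ∀ r u, ∑ a, pA r u a = 1)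
    (pU : U → ℝ) (pQ : U → Q → ℝ) (pR : Q → R → ℝ) (u : U) (q : Q) (r : R) :
    ∑ a, sfdJoint pU pQ pR pA u q r a = pU u * pQ u q * pR q r := by
  simp only [sfdJoint, ← Finset.mul_sum, hA1, mul_one]

omit [Fintype U] [Fintype Q] in
lemma sum_sum_sfdJoint_eq {pR : Q → R → ℝ} {pA : R → U → A → ℝ}
    (hR1 : ∀ q, ∑ r, pR q r = 1) (hA1 : ∀ r u, ∑ a, pA r u a = 1)
    (pU : U → ℝ) (pQ : U → Q → ℝ) (u : U) (q : Q) :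
    ∑ r, ∑ a, sfdJoint pU pQ pR pA u q r a = pU u * pQ u q := by
  simp only [sum_sfdJoint_eq hA1, ← Finset.mul_sum, hR1, mul_one]

omit [Fintype Q] in
lemma sfdPrq_eq_sfdPq_mul {pR : Q → R → ℝ} {pA : R → U → A → ℝ}
    (hR1 : ∀ q, ∑ r, pR q r = 1) (hA1 : ∀ r u, ∑ a, pA r u a = 1)
    (pU : U → ℝ) (pQ : U → Q → ℝ) (q : Q) (r : R) :
    sfdPrq pU pQ pR pA r q = sfdPq pU pQ pR pA q * pR q r := by
  simp only [sfdPrq, sfdPq, sum_sum_sfdJoint_eq hR1 hA1]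
  simp only [sum_sfdJoint_eq hA1, Finset.sum_mul]

/-- In the standard front-door SCM, for every `u, q, r` with `P_obs(q, r) > 0` and
`P_obs(q) > 0`, the posterior over the unobserved confounder is unchanged by further
conditioning on the mediator: `P_obs(u | q, r) = P_obs(u | q)`. Consequently,
`P_obs(a | r, q) = ∑ u, pA(r)(u)(a) * P_obs(u | q)` for every `a`. -/
theorem standard_front_door_confounder_posterior
    [Nonempty U] [Nonempty Q] [Nonempty R] [Nonempty A]
    (pU : U → ℝ) (pQ : U → Q → ℝ) (pR : Q → R → ℝ) (pA : R → U → A → ℝ)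
    (hpU : ∀ u, 0 ≤ pU u) (hpQ : ∀ u q, 0 ≤ pQ u q)
    (hpR : ∀ q r, 0 ≤ pR q r) (hpA : ∀ r u a, 0 ≤ pA r u a)
    (hU1 : ∑ u, pU u = 1) (hQ1 : ∀ u, ∑ q, pQ u q = 1)
    (hR1 : ∀ q, ∑ r, pR q r = 1) (hA1 : ∀ r u, ∑ a, pA r u a = 1)
    (u : U) (q : Q) (r : R)
    (hqr : 0 < sfdPrq pU pQ pR pA r q) (hq : 0 < sfdPq pU pQ pR pA q) :
    ((∑ a, sfdJoint pU pQ pR pA u q r a) / sfdPrq pU pQ pR pA r q =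
        (∑ r', ∑ a, sfdJoint pU pQ pR pA u q r' a) / sfdPq pU pQ pR pA q) ∧
    (∀ a : A, (∑ u', sfdJoint pU pQ pR pA u' q r a) / sfdPrq pU pQ pR pA r q =
        ∑ u', pA r u' a *
          ((∑ r', ∑ a', sfdJoint pU pQ pR pA u' q r' a') / sfdPq pU pQ pR pA q)) := by
  have hrq := sfdPrq_eq_sfdPq_mul hR1 hA1 pU pQ q r
  have hr : pR q r ≠ 0 := right_ne_zero_of_mul (hrq ▸ hqr.ne')
  simp only [sum_sum_sfdJoint_eq hR1 hA1]
  simp only [sum_sfdJoint_eq hA1, hrq]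
  refine ⟨mul_div_mul_right _ _ hr, fun a => ?_⟩
  rw [Finset.sum_div]
  refine Finset.sum_congr rfl fun u' _ => ?_
  rw [sfdJoint, mul_right_comm, mul_div_mul_right _ _ hr, mul_comm _ (pA r u' a), mul_div_assoc]
end

section
/- In the conditional front-door SCM, for every query value q* ∈ Q and every answer a ∈ A, the interventional probability satisfies the conditional front-door adjustment formula P(a | do(Q=q*)) = Σ_{r∈R} Σ_{e∈E} P_obs(r | q*, e) · ( Σ_{q∈Q} P_obs(a | r, q, e) · P_obs(q | e) ) · P_obs(e), provided that P_obs(e) > 0 for every e ∈ E, P_obs(q, e) > 0 for every q ∈ Q and e ∈ E, and P_obs(r, q, e) > 0 for every r ∈ R, q ∈ Q, e ∈ E. -/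
open Finset

variable {U E Q R A : Type*} [Fintype U] [Fintype E] [Fintype Q] [Fintype R] [Fintype A]

/-- Observational joint distribution of the conditional front-door SCM:
`p(u, e, q, r, a) = pU(u) * pE(e) * pQ(u)(e)(q) * pR(q)(e)(r) * pA(r)(u)(e)(a)`. -/
def cfdJoint (pU : U → ℝ) (pE : E → ℝ) (pQ : U → E → Q → ℝ) (pR : Q → E → R → ℝ)
    (pA : R → U → E → A → ℝ) (u : U) (e : E) (q : Q) (r : R) (a : A) : ℝ :=
  pU u * pE e * pQ u e q * pR q e r * pA r u e a

/-- Observational marginal `P_obs(e)`. -/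
def cfdPe (pU : U → ℝ) (pE : E → ℝ) (pQ : U → E → Q → ℝ) (pR : Q → E → R → ℝ)
    (pA : R → U → E → A → ℝ) (e : E) : ℝ :=
  ∑ u, ∑ q, ∑ r, ∑ a, cfdJoint pU pE pQ pR pA u e q r a

/-- Observational marginal `P_obs(q, e)`. -/
def cfdPqe (pU : U → ℝ) (pE : E → ℝ) (pQ : U → E → Q → ℝ) (pR : Q → E → R → ℝ)
    (pA : R → U → E → A → ℝ) (q : Q) (e : E) : ℝ :=
  ∑ u, ∑ r, ∑ a, cfdJoint pU pE pQ pR pA u e q r a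

/-- Observational marginal `P_obs(r, q, e)`. -/
def cfdPrqe (pU : U → ℝ) (pE : E → ℝ) (pQ : U → E → Q → ℝ) (pR : Q → E → R → ℝ)
    (pA : R → U → E → A → ℝ) (r : R) (q : Q) (e : E) : ℝ :=
  ∑ u, ∑ a, cfdJoint pU pE pQ pR pA u e q r a

section Marginals

variable (pU : U → ℝ) (pE : E → ℝ) (pQ : U → E → Q → ℝ) (pR : Q → E → R → ℝ)
  (pA : R → U → E → A → ℝ)

omit [Fintype E] [Fintype Q] [Fintype R] in
theorem cfdPrqe_eq (hA1 : ∀ r u e, ∑ a, pA r u e a = 1) (r : R) (q : Q) (e : E) :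
    cfdPrqe pU pE pQ pR pA r q e = pE e * (∑ u, pU u * pQ u e q) * pR q e r := by
  simp only [cfdPrqe, cfdJoint, ← mul_sum, hA1, mul_one]
  rw [mul_sum, sum_mul]
  exact sum_congr rfl fun u _ => by ring

omit [Fintype E] [Fintype Q] in
theorem cfdPqe_eq (hR1 : ∀ q e, ∑ r, pR q e r = 1) (hA1 : ∀ r u e, ∑ a, pA r u e a = 1)
    (q : Q) (e : E) :
    cfdPqe pU pE pQ pR pA q e = pE e * ∑ u, pU u * pQ u e q := by
  simp only [cfdPqe, cfdJoint, ← mul_sum, hA1, hR1, mul_one]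
  rw [mul_sum]
  exact sum_congr rfl fun u _ => by ring

omit [Fintype E] in
theorem cfdPe_eq (hU1 : ∑ u, pU u = 1) (hQ1 : ∀ u e, ∑ q, pQ u e q = 1)
    (hR1 : ∀ q e, ∑ r, pR q e r = 1) (hA1 : ∀ r u e, ∑ a, pA r u e a = 1) (e : E) :
    cfdPe pU pE pQ pR pA e = pE e := by
  simp only [cfdPe, cfdJoint, ← mul_sum, hA1, hR1, hQ1, mul_one]
  rw [← sum_mul, hU1, one_mul]

omit [Fintype E] [Fintype Q] [Fintype R] [Fintype A] in
theorem sum_cfdJoint (e : E) (q : Q) (r : R) (a : A) :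
    ∑ u, cfdJoint pU pE pQ pR pA u e q r a =
      pE e * pR q e r * ∑ u, pU u * pQ u e q * pA r u e a := by
  rw [mul_sum]
  exact sum_congr rfl fun u _ => by rw [cfdJoint]; ring

end Marginals

/-- **Conditional front-door adjustment.**
For every query value `q*` and answer `a`, the interventional probability
`P(a | do(Q = q*)) = ∑ u, ∑ e, ∑ r, pU(u) * pE(e) * pR(q*)(e)(r) * pA(r)(u)(e)(a)`
equals `∑ r, ∑ e, P_obs(r | q*, e) * (∑ q, P_obs(a | r, q, e) * P_obs(q | e)) * P_obs(e)`,
provided `P_obs(e) > 0`, `P_obs(q, e) > 0` and `P_obs(r, q, e) > 0` everywhere. -/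
theorem conditional_front_door_adjustment
    [Nonempty U] [Nonempty E] [Nonempty Q] [Nonempty R] [Nonempty A]
    (pU : U → ℝ) (pE : E → ℝ) (pQ : U → E → Q → ℝ) (pR : Q → E → R → ℝ)
    (pA : R → U → E → A → ℝ)
    (hpU : ∀ u, 0 ≤ pU u) (hpE : ∀ e, 0 ≤ pE e)
    (hpQ : ∀ u e q, 0 ≤ pQ u e q) (hpR : ∀ q e r, 0 ≤ pR q e r)
    (hpA : ∀ r u e a, 0 ≤ pA r u e a)
    (hU1 : ∑ u, pU u = 1) (hE1 : ∑ e, pE e = 1)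
    (hQ1 : ∀ u e, ∑ q, pQ u e q = 1) (hR1 : ∀ q e, ∑ r, pR q e r = 1)
    (hA1 : ∀ r u e, ∑ a, pA r u e a = 1)
    (he : ∀ e : E, 0 < cfdPe pU pE pQ pR pA e)
    (hqe : ∀ (q : Q) (e : E), 0 < cfdPqe pU pE pQ pR pA q e)
    (hrqe : ∀ (r : R) (q : Q) (e : E), 0 < cfdPrqe pU pE pQ pR pA r q e)
    (qstar : Q) (a : A) :
    (∑ u, ∑ e, ∑ r, pU u * pE e * pR qstar e r * pA r u e a) =
      ∑ r, ∑ e, (cfdPrqe pU pE pQ pR pA r qstar e / cfdPqe pU pE pQ pR pA qstar e) *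
        (∑ q, ((∑ u, cfdJoint pU pE pQ pR pA u e q r a) / cfdPrqe pU pE pQ pR pA r q e) *
          (cfdPqe pU pE pQ pR pA q e / cfdPe pU pE pQ pR pA e)) *
        cfdPe pU pE pQ pR pA e := by
  have hE (e : E) : pE e ≠ 0 := by
    have h := (he e).ne'
    rwa [cfdPe_eq pU pE pQ pR pA hU1 hQ1 hR1 hA1] at h
  have hW (q : Q) (e : E) : ∑ u, pU u * pQ u e q ≠ 0 := by
    have h := (hqe q e).ne'
    rw [cfdPqe_eq pU pE pQ pR pA hR1 hA1] at h
    exact right_ne_zero_of_mul h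
  have hR (r : R) (q : Q) (e : E) : pR q e r ≠ 0 := by
    have h := (hrqe r q e).ne'
    rw [cfdPrqe_eq pU pE pQ pR pA hA1] at h
    exact right_ne_zero_of_mul h
  have inner (r : R) (e : E) :
      ∑ q, ((∑ u, cfdJoint pU pE pQ pR pA u e q r a) / cfdPrqe pU pE pQ pR pA r q e) *
        (cfdPqe pU pE pQ pR pA q e / cfdPe pU pE pQ pR pA e) = ∑ u, pU u * pA r u e a := by
    calc
      _ = ∑ q, ∑ u, pU u * pQ u e q * pA r u e a := by
        refine sum_congr rfl fun q _ => ?_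
        rw [sum_cfdJoint, cfdPrqe_eq pU pE pQ pR pA hA1, cfdPqe_eq pU pE pQ pR pA hR1 hA1,
          cfdPe_eq pU pE pQ pR pA hU1 hQ1 hR1 hA1]
        have h₁ := hE e
        have h₂ := hW q e
        have h₃ := hR r q e
        generalize ∑ u, pU u * pQ u e q = w at h₂ ⊢
        field_simp
      _ = ∑ u, pU u * pA r u e a := by
        rw [sum_comm]
        refine sum_congr rfl fun u _ => ?_
        rw [← sum_mul, ← mul_sum, hQ1, mul_one]
  have outer (r : R) (e : E) :
      cfdPrqe pU pE pQ pR pA r qstar e / cfdPqe pU pE pQ pR pA qstar e = pR qstar e r := by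
    rw [cfdPrqe_eq pU pE pQ pR pA hA1, cfdPqe_eq pU pE pQ pR pA hR1 hA1]
    exact mul_div_cancel_left₀ _ (mul_ne_zero (hE e) (hW qstar e))
  simp only [inner, outer]
  simp only [cfdPe_eq pU pE pQ pR pA hU1 hQ1 hR1 hA1]
  rw [sum_comm, sum_comm (s := (univ : Finset R))]
  refine sum_congr rfl fun e _ => ?_
  rw [sum_comm]
  refine sum_congr rfl fun r _ => ?_
  rw [mul_sum, sum_mul]
  exact sum_congr rfl fun u _ => by ring
end

section
/- In the conditional front-door SCM, for every u ∈ U, q ∈ Q, e ∈ E, r ∈ R with P_obs(q, e) > 0 and P_obs(r, q, e) > 0, the posterior over the unobserved confounder is unchanged by further conditioning on the mediator: P_obs(u | r, q, e) = P_obs(u | q, e). Consequently, P_obs(a | r, q, e) = Σ_{u∈U} pA(r)(u)(e)(a) · P_obs(u | q, e) for every a ∈ A. -/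
open Finset

variable {U E Q R A : Type*} [Fintype U] [Fintype E] [Fintype Q] [Fintype R] [Fintype A]

/-- Summing out the action leaves `P_obs(u, e, q, r)`. -/
theorem sum_cfdJoint_action {U E Q R A : Type*} [Fintype A]
    (pU : U → ℝ) (pE : E → ℝ) (pQ : U → E → Q → ℝ) (pR : Q → E → R → ℝ)
    (pA : R → U → E → A → ℝ) (hA1 : ∀ r u e, ∑ a, pA r u e a = 1)
    (u : U) (e : E) (q : Q) (r : R) :
    ∑ a, cfdJoint pU pE pQ pR pA u e q r a = pU u * pE e * pQ u e q * pR q e r := by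
  simp only [cfdJoint, ← Finset.mul_sum, hA1, mul_one]

/-- The mediator is independent of the confounder given `q` and `e`, so
`P_obs(r, q, e) = P_obs(q, e) * pR(q)(e)(r)`. -/
theorem cfdPrqe_eq_cfdPqe_mul {U E Q R A : Type*} [Fintype U] [Fintype R] [Fintype A]
    (pU : U → ℝ) (pE : E → ℝ) (pQ : U → E → Q → ℝ)
    (pR : Q → E → R → ℝ) (pA : R → U → E → A → ℝ) (hR1 : ∀ q e, ∑ r, pR q e r = 1)
    (hA1 : ∀ r u e, ∑ a, pA r u e a = 1) (r : R) (q : Q) (e : E) :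
    cfdPrqe pU pE pQ pR pA r q e = cfdPqe pU pE pQ pR pA q e * pR q e r := by
  simp only [cfdPrqe, cfdPqe, sum_cfdJoint_action pU pE pQ pR pA hA1, ← Finset.mul_sum, hR1,
    mul_one, ← Finset.sum_mul]

/-- In the conditional front-door SCM, for every `u, q, e, r` with `P_obs(q, e) > 0`
and `P_obs(r, q, e) > 0`, the posterior over the unobserved confounder is unchanged by
further conditioning on the mediator: `P_obs(u | r, q, e) = P_obs(u | q, e)`.
Consequently, `P_obs(a | r, q, e) = ∑ u, pA(r)(u)(e)(a) * P_obs(u | q, e)` for every `a`. -/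
theorem conditional_front_door_confounder_posterior
    [Nonempty U] [Nonempty E] [Nonempty Q] [Nonempty R] [Nonempty A]
    (pU : U → ℝ) (pE : E → ℝ) (pQ : U → E → Q → ℝ) (pR : Q → E → R → ℝ)
    (pA : R → U → E → A → ℝ)
    (hpU : ∀ u, 0 ≤ pU u) (hpE : ∀ e, 0 ≤ pE e)
    (hpQ : ∀ u e q, 0 ≤ pQ u e q) (hpR : ∀ q e r, 0 ≤ pR q e r)
    (hpA : ∀ r u e a, 0 ≤ pA r u e a)
    (hU1 : ∑ u, pU u = 1) (hE1 : ∑ e, pE e = 1)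
    (hQ1 : ∀ u e, ∑ q, pQ u e q = 1) (hR1 : ∀ q e, ∑ r, pR q e r = 1)
    (hA1 : ∀ r u e, ∑ a, pA r u e a = 1)
    (u : U) (q : Q) (e : E) (r : R)
    (hqe : 0 < cfdPqe pU pE pQ pR pA q e)
    (hrqe : 0 < cfdPrqe pU pE pQ pR pA r q e) :
    ((∑ a, cfdJoint pU pE pQ pR pA u e q r a) / cfdPrqe pU pE pQ pR pA r q e =
        (∑ r', ∑ a, cfdJoint pU pE pQ pR pA u e q r' a) / cfdPqe pU pE pQ pR pA q e) ∧
    (∀ a : A, (∑ u', cfdJoint pU pE pQ pR pA u' e q r a) / cfdPrqe pU pE pQ pR pA r q e =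
        ∑ u', pA r u' e a *
          ((∑ r', ∑ a', cfdJoint pU pE pQ pR pA u' e q r' a') /
            cfdPqe pU pE pQ pR pA q e)) := by
  have hrq := cfdPrqe_eq_cfdPqe_mul pU pE pQ pR pA hR1 hA1 r q e
  have hR : pR q e r ≠ 0 := by
    intro h
    simp [hrq, h] at hrqe
  simp only [sum_cfdJoint_action pU pE pQ pR pA hA1, ← Finset.mul_sum, hR1, mul_one, hrq]
  refine ⟨mul_div_mul_right _ _ hR, fun a => ?_⟩
  rw [Finset.sum_div]
  refine Finset.sum_congr rfl fun u' _ => ?_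
  rw [cfdJoint, ← mul_div_mul_right (pU u' * pE e * pQ u' e q) _ hR]
  ring
end

section
/- In the conditional front-door SCM, intervening on the mediator is observationally equivalent once the query and the external knowledge are conditioned on: for every r* ∈ R, q ∈ Q, e ∈ E with P_obs(q, e) > 0 and P_obs(r*, q, e) > 0, and every a ∈ A, the interventional conditional P(a | q, e, do(R=r*)), defined from the truncated joint p_{do(r*)}(u,e,q,a) := pU(u)·pE(e)·pQ(u)(e)(q)·pA(r*)(u)(e)(a) by conditioning on (q, e), equals the observational conditional P_obs(a | r*, q, e). -/
open Finset

variable {U E Q R A : Type*} [Fintype U] [Fintype E] [Fintype Q] [Fintype R] [Fintype A]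

/-- In the conditional front-door SCM, intervening on the mediator is observationally
equivalent once the query and the external knowledge are conditioned on: for every
`r*, q, e` with `P_obs(q, e) > 0` and `P_obs(r*, q, e) > 0` and every `a`,
the interventional conditional `P(a | q, e, do(R = r*))` — obtained from the truncated
joint `p_{do(r*)}(u, e, q, a) = pU(u) * pE(e) * pQ(u)(e)(q) * pA(r*)(u)(e)(a)` by
conditioning on `(q, e)` — equals the observational conditional `P_obs(a | r*, q, e)`. -/
theorem conditional_front_door_mediator_intervention_equiv
    [Nonempty U] [Nonempty E] [Nonempty Q] [Nonempty R] [Nonempty A]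
    (pU : U → ℝ) (pE : E → ℝ) (pQ : U → E → Q → ℝ) (pR : Q → E → R → ℝ)
    (pA : R → U → E → A → ℝ)
    (hpU : ∀ u, 0 ≤ pU u) (hpE : ∀ e, 0 ≤ pE e)
    (hpQ : ∀ u e q, 0 ≤ pQ u e q) (hpR : ∀ q e r, 0 ≤ pR q e r)
    (hpA : ∀ r u e a, 0 ≤ pA r u e a)
    (hU1 : ∑ u, pU u = 1) (hE1 : ∑ e, pE e = 1)
    (hQ1 : ∀ u e, ∑ q, pQ u e q = 1) (hR1 : ∀ q e, ∑ r, pR q e r = 1)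
    (hA1 : ∀ r u e, ∑ a, pA r u e a = 1)
    (rstar : R) (q : Q) (e : E)
    (hqe : 0 < cfdPqe pU pE pQ pR pA q e)
    (hrqe : 0 < cfdPrqe pU pE pQ pR pA rstar q e)
    (a : A) :
    (∑ u, pU u * pE e * pQ u e q * pA rstar u e a) /
        (∑ u, ∑ a', pU u * pE e * pQ u e q * pA rstar u e a') =
      (∑ u, cfdJoint pU pE pQ pR pA u e q rstar a) /
        cfdPrqe pU pE pQ pR pA rstar q e := by
  have hfactor (u : U) (b : A) : cfdJoint pU pE pQ pR pA u e q rstar b =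
      pU u * pE e * pQ u e q * pA rstar u e b * pR q e rstar := by
    unfold cfdJoint
    ring
  have hden : cfdPrqe pU pE pQ pR pA rstar q e =
      (∑ u, ∑ b, pU u * pE e * pQ u e q * pA rstar u e b) * pR q e rstar := by
    simp only [cfdPrqe, hfactor, Finset.sum_mul]
  have hR : pR q e rstar ≠ 0 := by
    intro h
    simp [hden, h] at hrqe
  rw [hden]
  simp only [hfactor, ← Finset.sum_mul]
  exact (mul_div_mul_right _ _ hR).symm
end

section
/- In the conditional front-door SCM with a fixed query, i.e., when pQ(u)(e)(q) equals 1 if q = q* and 0 otherwise for a fixed q* ∈ Q and all u ∈ U, e ∈ E, the conditional front-door adjustment formula simplifies as stated in the paper: P(a | do(Q=q*)) = Σ_{r∈R} Σ_{e∈E} P_obs(r | q*, e) · P_obs(a | r, q*, e) · pE(e) for every a ∈ A, provided that pE(e) > 0 for every e ∈ E and P_obs(r, q*, e) > 0 for every r ∈ R and e ∈ E. -/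
open Finset

variable {U E Q R A : Type*} [Fintype U] [Fintype E] [Fintype Q] [Fintype R] [Fintype A]

/-- Under the point mass `pQ u e q = 1` at `q`, the marginal `P_obs(q, e)` equals `pE e`. -/
theorem cfdPqe_eq_of_point (pU : U → ℝ) (pE : E → ℝ) (pQ : U → E → Q → ℝ)
    (pR : Q → E → R → ℝ) (pA : R → U → E → A → ℝ) (q : Q) (e : E)
    (hU1 : ∑ u, pU u = 1) (hQ : ∀ u, pQ u e q = 1) (hR1 : ∑ r, pR q e r = 1)
    (hA1 : ∀ r u, ∑ a, pA r u e a = 1) :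
    cfdPqe pU pE pQ pR pA q e = pE e := by
  simp only [cfdPqe, cfdJoint, hQ, ← Finset.mul_sum, hA1, mul_one, hR1]
  rw [← Finset.sum_mul, hU1, one_mul]

/-- In the conditional front-door SCM with a fixed query, i.e. when `pQ(u)(e)(q)` is
`1` if `q = q*` and `0` otherwise, the conditional front-door adjustment formula
simplifies to
`P(a | do(Q = q*)) = ∑ r, ∑ e, P_obs(r | q*, e) * P_obs(a | r, q*, e) * pE(e)`
for every `a`, provided `pE(e) > 0` for every `e` and `P_obs(r, q*, e) > 0` for
every `r, e`. -/
theorem conditional_front_door_adjustment_fixed_query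
    [DecidableEq Q]
    [Nonempty U] [Nonempty E] [Nonempty Q] [Nonempty R] [Nonempty A]
    (pU : U → ℝ) (pE : E → ℝ) (pQ : U → E → Q → ℝ) (pR : Q → E → R → ℝ)
    (pA : R → U → E → A → ℝ)
    (hpU : ∀ u, 0 ≤ pU u) (hpE : ∀ e, 0 ≤ pE e)
    (hpQ : ∀ u e q, 0 ≤ pQ u e q) (hpR : ∀ q e r, 0 ≤ pR q e r)
    (hpA : ∀ r u e a, 0 ≤ pA r u e a)
    (hU1 : ∑ u, pU u = 1) (hE1 : ∑ e, pE e = 1)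
    (hQ1 : ∀ u e, ∑ q, pQ u e q = 1) (hR1 : ∀ q e, ∑ r, pR q e r = 1)
    (hA1 : ∀ r u e, ∑ a, pA r u e a = 1)
    (qstar : Q)
    (hpointQ : ∀ u e q, pQ u e q = if q = qstar then 1 else 0)
    (he : ∀ e : E, 0 < pE e)
    (hrqe : ∀ (r : R) (e : E), 0 < cfdPrqe pU pE pQ pR pA r qstar e)
    (a : A) :
    (∑ u, ∑ e, ∑ r, pU u * pE e * pR qstar e r * pA r u e a) =
      ∑ r, ∑ e, (cfdPrqe pU pE pQ pR pA r qstar e / cfdPqe pU pE pQ pR pA qstar e) *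
        ((∑ u, cfdJoint pU pE pQ pR pA u e qstar r a) /
          cfdPrqe pU pE pQ pR pA r qstar e) *
        pE e := by
  have hQ : ∀ u e, pQ u e qstar = 1 := fun u e => by simp [hpointQ]
  calc
    (∑ u, ∑ e, ∑ r, pU u * pE e * pR qstar e r * pA r u e a) =
        ∑ r, ∑ e, ∑ u, pU u * pE e * pR qstar e r * pA r u e a := by
      rw [Finset.sum_comm]
      simp_rw [Finset.sum_comm (s := (univ : Finset U))]
      exact Finset.sum_comm
    _ = _ := by
      refine Finset.sum_congr rfl fun r _ => Finset.sum_congr rfl fun e _ => ?_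
      have hPqe : cfdPqe pU pE pQ pR pA qstar e = pE e :=
        cfdPqe_eq_of_point pU pE pQ pR pA qstar e hU1 (fun u => hQ u e) (hR1 qstar e)
          fun r u => hA1 r u e
      have hpe := (he e).ne'
      have hpr := (hrqe r e).ne'
      rw [hPqe]
      field_simp
      simp [cfdJoint, hQ]
end
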